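/- arXiv:1910.04417 — 4 statements merged into one kernel-verified Lean document; each statement's English description precedes it below -/
import Mathlib

section
/- Let S and A be finite nonempty types, T : S × A → PMF S a Markov kernel (the shared dynamics), and let μπ, μE be probability mass functions on S × A with μπ absolutely continuous with respect to μE. Let ρπ, ρE be the induced joint distributions on S × A × S, ρ(s,a,s') = μ(s,a)·T(s,a)(s'), let ρπ(s,s'), ρE(s,s') denote their state-transition marginals, and let the inverse dynamics disagreement be D_KL(ρπ(a|s,s') ‖ ρE(a|s,s')) := Σ_{(s,a,s')} ρπ(s,a,s')·log(ρπ(a|s,s')/ρE(a|s,s')), where ρ(a|s,s') = ρ(s,a,s')/ρ(s,s') whenever ρ(s,s') > 0. Then D_KL(ρπ(a|s,s') ‖ ρE(a|s,s')) = D_KL(μπ ‖ μE) − D_KL(ρπ(s,s') ‖ ρE(s,s')). -/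
open scoped BigOperators

/-- Kullback–Leibler divergence: `D_KL(p ‖ q) = Σ_x p(x)·log(p(x)/q(x))`,
with terms where `p x = 0` equal to `0`. -/
noncomputable def klDiv {X : Type*} [Fintype X] (p q : X → ℝ) : ℝ :=
  ∑ x, p x * Real.log (p x / q x)

/-- The real-valued mass function of a `PMF`. -/
noncomputable def pmfReal {X : Type*} (μ : PMF X) : X → ℝ := fun x => (μ x).toReal

/-- The joint distribution on `S × A × S` induced by a state-action occupancy
measure `μ` and a Markov kernel `T`: `ρ(s,a,s') = μ(s,a) · T(s,a)(s')`. -/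
noncomputable def joint {S A : Type*} (T : S × A → PMF S) (μ : PMF (S × A)) :
    S × A × S → ℝ :=
  fun x => (μ (x.1, x.2.1)).toReal * ((T (x.1, x.2.1)) x.2.2).toReal

/-- The state-transition marginal `ρ(s,s') = Σ_a ρ(s,a,s')`. -/
noncomputable def transMarg {S A : Type*} [Fintype A]
    (T : S × A → PMF S) (μ : PMF (S × A)) : S × S → ℝ :=
  fun p => ∑ a : A, joint T μ (p.1, a, p.2)

/-- The inverse dynamics conditional `ρ(a|s,s') = ρ(s,a,s') / ρ(s,s')`,
meaningful whenever `ρ(s,s') > 0`. -/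
noncomputable def invCond {S A : Type*} [Fintype A]
    (T : S × A → PMF S) (μ : PMF (S × A)) : S × A × S → ℝ :=
  fun x => joint T μ x / transMarg T μ (x.1, x.2.2)

/-- The inverse dynamics disagreement
`D_KL(ρπ(a|s,s') ‖ ρE(a|s,s')) = Σ_{(s,a,s')} ρπ(s,a,s')·log(ρπ(a|s,s')/ρE(a|s,s'))`. -/
noncomputable def invDynDisagreement {S A : Type*} [Fintype S] [Fintype A]
    (T : S × A → PMF S) (μπ μE : PMF (S × A)) : ℝ :=
  ∑ x : S × A × S, joint T μπ x * Real.log (invCond T μπ x / invCond T μE x)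

theorem joint_nonneg {S A : Type*} (T : S × A → PMF S) (μ : PMF (S × A)) (x : S × A × S) :
    0 ≤ joint T μ x :=
  mul_nonneg ENNReal.toReal_nonneg ENNReal.toReal_nonneg

theorem joint_le_transMarg {S A : Type*} [Fintype A] (T : S × A → PMF S) (μ : PMF (S × A))
    (s : S) (a : A) (s' : S) : joint T μ (s, a, s') ≤ transMarg T μ (s, s') :=
  Finset.single_le_sum (f := fun a => joint T μ (s, a, s'))
    (fun _ _ => joint_nonneg T μ _) (Finset.mem_univ a)

theorem PMF.sum_toReal_eq_one {X : Type*} [Fintype X] (p : PMF X) :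
    ∑ x, (p x).toReal = 1 := by
  rw [← ENNReal.toReal_sum fun x _ => p.apply_ne_top x, ← tsum_fintype (L := .unconditional X),
    p.tsum_coe, ENNReal.toReal_one]

/-- Pointwise chain rule: the conditional log-ratio is the difference of the occupancy and
transition log-ratios, the kernel cancelling. -/
theorem joint_mul_log_invCond_div {S A : Type*} [Fintype A] (T : S × A → PMF S)
    (μπ μE : PMF (S × A)) (hac : ∀ x : S × A, 0 < μπ x → 0 < μE x) (s : S) (a : A) (s' : S) :
    joint T μπ (s, a, s') * Real.log (invCond T μπ (s, a, s') / invCond T μE (s, a, s')) =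
      joint T μπ (s, a, s') * Real.log (pmfReal μπ (s, a) / pmfReal μE (s, a)) -
        joint T μπ (s, a, s') *
          Real.log (transMarg T μπ (s, s') / transMarg T μE (s, s')) := by
  obtain h | h := (joint_nonneg T μπ (s, a, s')).eq_or_lt
  · simp [← h]
  have hprod : (μπ (s, a)).toReal * (T (s, a) s').toReal ≠ 0 := h.ne'
  have hπ : 0 < (μπ (s, a)).toReal :=
    ENNReal.toReal_nonneg.lt_of_ne' (left_ne_zero_of_mul hprod)
  have hT : 0 < (T (s, a) s').toReal :=
    ENNReal.toReal_nonneg.lt_of_ne' (right_ne_zero_of_mul hprod)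
  have hE : 0 < (μE (s, a)).toReal :=
    ENNReal.toReal_pos (hac _ (ENNReal.toReal_pos_iff.1 hπ).1).ne' (μE.apply_ne_top _)
  have hmπ : 0 < transMarg T μπ (s, s') := h.trans_le (joint_le_transMarg T μπ s a s')
  have hmE : 0 < transMarg T μE (s, s') :=
    (mul_pos hE hT).trans_le (joint_le_transMarg T μE s a s')
  simp only [invCond, joint, pmfReal]
  rw [← mul_sub, ← Real.log_div (div_pos hπ hE).ne' (div_pos hmπ hmE).ne']
  congr 2
  field_simp

/-- The inverse dynamics disagreement is exactly the gap between LfD and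
naive LfO: `D_KL(ρπ(a|s,s') ‖ ρE(a|s,s')) = D_KL(μπ ‖ μE) − D_KL(ρπ(s,s') ‖ ρE(s,s'))`. -/
theorem invDynDisagreement_eq_lfd_sub_lfo {S A : Type*}
    [Fintype S] [Fintype A] [Nonempty S] [Nonempty A]
    (T : S × A → PMF S) (μπ μE : PMF (S × A))
    (hac : ∀ x : S × A, 0 < μπ x → 0 < μE x) :
    invDynDisagreement T μπ μE =
      klDiv (pmfReal μπ) (pmfReal μE) - klDiv (transMarg T μπ) (transMarg T μE) := by
  have hocc : ∑ s, ∑ a, ∑ s', joint T μπ (s, a, s') *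
      Real.log (pmfReal μπ (s, a) / pmfReal μE (s, a)) = klDiv (pmfReal μπ) (pmfReal μE) := by
    simp only [klDiv, Fintype.sum_prod_type, ← Finset.sum_mul, joint, ← Finset.mul_sum,
      PMF.sum_toReal_eq_one, mul_one, pmfReal]
  have htrans : ∑ s, ∑ a, ∑ s', joint T μπ (s, a, s') *
      Real.log (transMarg T μπ (s, s') / transMarg T μE (s, s')) =
        klDiv (transMarg T μπ) (transMarg T μE) := by
    simp only [klDiv, Fintype.sum_prod_type]
    refine Finset.sum_congr rfl fun s _ => ?_
    rw [Finset.sum_comm]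
    exact Finset.sum_congr rfl fun s' _ => (Finset.sum_mul ..).symm
  simp only [invDynDisagreement, Fintype.sum_prod_type, joint_mul_log_invCond_div T μπ μE hac,
    Finset.sum_sub_distrib, hocc, htrans]
end

section
/- Let S and A be finite nonempty types and f : S × A → S a function such that for every s ∈ S, the map a ↦ f(s,a) is injective (injective deterministic dynamics). Let T : S × A → PMF S be the deterministic kernel T(s,a) = δ_{f(s,a)} (point mass at f(s,a)). Let μπ, μE be probability mass functions on S × A with μπ absolutely continuous with respect to μE, and let ρπ(s,s'), ρE(s,s') be the state-transition marginals of the induced joint distributions ρ(s,a,s') = μ(s,a)·T(s,a)(s'). Then LfD equals naive LfO: D_KL(μπ ‖ μE) = D_KL(ρπ(s,s') ‖ ρE(s,s')). -/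
open scoped BigOperators

/-- Under injective deterministic dynamics, `(s, a) ↦ (s, f (s, a))` is injective. -/
theorem injective_fst_prod {S A : Type*} {f : S × A → S}
    (hf : ∀ s : S, Function.Injective fun a : A => f (s, a)) :
    Function.Injective fun x : S × A => (x.1, f x) := by
  rintro ⟨s, a⟩ ⟨t, b⟩ h
  obtain ⟨rfl, hab⟩ := Prod.mk.inj h
  exact congrArg (Prod.mk s) (hf s hab)

open scoped Classical in
theorem transMarg_pure {S A : Type*} [Fintype A] (f : S × A → S) (μ : PMF (S × A))
    (p : S × S) :
    transMarg (fun x => PMF.pure (f x)) μ p =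
      ∑ a : A, if p.2 = f (p.1, a) then (μ (p.1, a)).toReal else 0 := by
  simp only [transMarg, joint, PMF.pure_apply]
  refine Finset.sum_congr rfl fun a _ => ?_
  split_ifs <;> simp

theorem transMarg_pure_of_notMem_range {S A : Type*} [Fintype A] (f : S × A → S)
    (μ : PMF (S × A)) {p : S × S} (hp : p ∉ Set.range fun x : S × A => (x.1, f x)) :
    transMarg (fun x => PMF.pure (f x)) μ p = 0 := by
  classical
  rw [transMarg_pure]
  exact Finset.sum_eq_zero fun a _ => if_neg fun h => hp ⟨(p.1, a), Prod.ext rfl h.symm⟩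

theorem transMarg_pure_of_injective {S A : Type*} [Fintype A] {f : S × A → S}
    (hf : ∀ s : S, Function.Injective fun a : A => f (s, a)) (μ : PMF (S × A)) (x : S × A) :
    transMarg (fun x => PMF.pure (f x)) μ (x.1, f x) = pmfReal μ x := by
  classical
  rw [transMarg_pure, Finset.sum_eq_single x.2]
  · exact if_pos rfl
  · exact fun b _ hb => if_neg fun h => hb (hf x.1 h.symm)
  · simp

/-- If the dynamics is injective deterministic (`T(s,a) = δ_{f(s,a)}` with
`a ↦ f(s,a)` injective for each `s`), then LfD equals naive LfO:
`D_KL(μπ ‖ μE) = D_KL(ρπ(s,s') ‖ ρE(s,s'))`. -/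
theorem kl_stateAction_eq_kl_transMarg_of_injective_deterministic {S A : Type*}
    [Fintype S] [Fintype A] [Nonempty S] [Nonempty A]
    (f : S × A → S) (hf : ∀ s : S, Function.Injective fun a : A => f (s, a))
    (T : S × A → PMF S) (hT : ∀ p : S × A, T p = PMF.pure (f p))
    (μπ μE : PMF (S × A))
    (hac : ∀ x : S × A, 0 < μπ x → 0 < μE x) :
    klDiv (pmfReal μπ) (pmfReal μE) = klDiv (transMarg T μπ) (transMarg T μE) := by
  obtain rfl : T = fun x => PMF.pure (f x) := funext hT
  refine Fintype.sum_of_injective _ (injective_fst_prod hf) _ _ (fun p hp => ?_) fun x => ?_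
  · rw [transMarg_pure_of_notMem_range f μπ hp, zero_mul]
  · simp only [transMarg_pure_of_injective hf]
end

section
/- Let S and A be finite nonempty types and f : S × A → S a function such that for every s ∈ S, the map a ↦ f(s,a) is injective, and let T(s,a) = δ_{f(s,a)} be the associated deterministic kernel. Let μπ, μE be probability mass functions on S × A with induced joint distributions ρπ(s,a,s') = μπ(s,a)·T(s,a)(s') and ρE(s,a,s') = μE(s,a)·T(s,a)(s'), state-transition marginals ρπ(s,s'), ρE(s,s'), and inverse dynamics conditionals ρπ(a|s,s') = ρπ(s,a,s')/ρπ(s,s') (and similarly for ρE), defined wherever the marginal is positive. Then the inverse dynamics conditional is independent of the policy: for every (s,s') with ρπ(s,s') > 0 and ρE(s,s') > 0 and every a ∈ A, ρπ(a|s,s') = ρE(a|s,s'); namely both equal 1 if f(s,a) = s' and 0 otherwise. -/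
open scoped BigOperators

theorem joint_of_deterministic {S A : Type*} [DecidableEq S] {f : S × A → S}
    {T : S × A → PMF S} (hT : ∀ p : S × A, T p = PMF.pure (f p)) (μ : PMF (S × A))
    (s : S) (a : A) (s' : S) :
    joint T μ (s, a, s') = if f (s, a) = s' then (μ (s, a)).toReal else 0 := by
  by_cases h : f (s, a) = s'
  · simp [joint, hT, h]
  · simp [joint, hT, h, Ne.symm h]

/-- The inverse dynamics conditional of injective deterministic dynamics is the indicator of
the unique action realizing the transition. -/
theorem invCond_of_injective_deterministic {S A : Type*} [Fintype A] [DecidableEq S]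
    {f : S × A → S} {T : S × A → PMF S} (hT : ∀ p : S × A, T p = PMF.pure (f p))
    {s : S} (hf : Function.Injective fun a : A => f (s, a)) (μ : PMF (S × A)) {s' : S}
    (hpos : 0 < transMarg T μ (s, s')) (a : A) :
    invCond T μ (s, a, s') = if f (s, a) = s' then 1 else 0 := by
  by_cases h : f (s, a) = s'
  · have hmarg : transMarg T μ (s, s') = joint T μ (s, a, s') := by
      refine Finset.sum_eq_single a (fun b _ hb => ?_) (by simp)
      rw [joint_of_deterministic hT, if_neg fun hb' => hb (hf (hb'.trans h.symm))]
    rw [if_pos h]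
    change joint T μ (s, a, s') / transMarg T μ (s, s') = 1
    rw [← hmarg, div_self hpos.ne']
  · simp [invCond, joint_of_deterministic hT, h]

/-- For injective deterministic dynamics the inverse dynamics conditional is
independent of the policy: wherever both state-transition marginals are
positive, `ρπ(a|s,s') = ρE(a|s,s')`, and both equal `1` if `f(s,a) = s'`
and `0` otherwise. -/
theorem invCond_policy_independent_of_injective_deterministic {S A : Type*}
    [Fintype S] [Fintype A] [Nonempty S] [Nonempty A] [DecidableEq S]
    (f : S × A → S) (hf : ∀ s : S, Function.Injective fun a : A => f (s, a))
    (T : S × A → PMF S) (hT : ∀ p : S × A, T p = PMF.pure (f p))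
    (μπ μE : PMF (S × A)) :
    ∀ s s' : S, 0 < transMarg T μπ (s, s') → 0 < transMarg T μE (s, s') →
      ∀ a : A,
        invCond T μπ (s, a, s') = invCond T μE (s, a, s') ∧
        invCond T μπ (s, a, s') = (if f (s, a) = s' then 1 else 0) := by
  intro s s' hπ hE a
  have hinv := invCond_of_injective_deterministic hT (hf s) μπ hπ a
  exact ⟨hinv.trans (invCond_of_injective_deterministic hT (hf s) μE hE a).symm, hinv⟩
end

section
/- Let S and A be finite nonempty types and f : S × A → S a function such that for every s ∈ S, the map a ↦ f(s,a) is injective, and let T(s,a) = δ_{f(s,a)} be the associated deterministic kernel. Let μπ, μE be probability mass functions on S × A and let ρπ(s,s'), ρE(s,s') be the state-transition marginals of the induced joint distributions ρ(s,a,s') = μ(s,a)·T(s,a)(s'). Then the Jensen–Shannon version of LfD equals that of naive LfO: D_JS(μπ ‖ μE) = D_JS(ρπ(s,s') ‖ ρE(s,s')). -/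
open scoped BigOperators

/-- Jensen–Shannon divergence:
`D_JS(p ‖ q) = (1/2)·D_KL(p ‖ m) + (1/2)·D_KL(q ‖ m)` with `m = (p + q)/2`. -/
noncomputable def jsDiv {X : Type*} [Fintype X] (p q : X → ℝ) : ℝ :=
  (1 / 2) * klDiv p (fun x => (p x + q x) / 2) +
    (1 / 2) * klDiv q (fun x => (p x + q x) / 2)

theorem klDiv_comp_of_injective {X Y : Type*} [Fintype X] [Fintype Y] (g : X → Y)
    (hg : Function.Injective g) (p q : Y → ℝ) (hp : ∀ y ∉ Set.range g, p y = 0) :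
    klDiv (p ∘ g) (q ∘ g) = klDiv p q :=
  Fintype.sum_of_injective g hg _ _ (fun y hy => by simp [hp y hy]) fun _ => rfl

theorem jsDiv_comp_of_injective {X Y : Type*} [Fintype X] [Fintype Y] (g : X → Y)
    (hg : Function.Injective g) (p q : Y → ℝ) (hp : ∀ y ∉ Set.range g, p y = 0)
    (hq : ∀ y ∉ Set.range g, q y = 0) :
    jsDiv (p ∘ g) (q ∘ g) = jsDiv p q := by
  unfold jsDiv
  rw [← klDiv_comp_of_injective g hg p _ hp, ← klDiv_comp_of_injective g hg q _ hq]
  rfl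

theorem transMarg_eq_zero_of_notMem_range {S A : Type*} [Fintype A] (f : S × A → S)
    (T : S × A → PMF S) (hT : ∀ p : S × A, T p = PMF.pure (f p)) (μ : PMF (S × A))
    (y : S × S) (hy : y ∉ Set.range fun x : S × A => (x.1, f x)) :
    transMarg T μ y = 0 := by
  refine Finset.sum_eq_zero fun a _ => ?_
  have h : y.2 ≠ f (y.1, a) := fun h => hy ⟨(y.1, a), Prod.ext rfl h.symm⟩
  simp [joint, hT, PMF.pure_apply, h]

theorem transMarg_comp_eq_pmfReal {S A : Type*} [Fintype A] (f : S × A → S)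
    (hf : ∀ s : S, Function.Injective fun a : A => f (s, a))
    (T : S × A → PMF S) (hT : ∀ p : S × A, T p = PMF.pure (f p)) (μ : PMF (S × A)) :
    (transMarg T μ ∘ fun x : S × A => (x.1, f x)) = pmfReal μ := by
  funext x
  refine (Fintype.sum_eq_single x.2 fun a ha => ?_).trans ?_
  · have h : f x ≠ f (x.1, a) := fun h => ha (hf x.1 h.symm)
    simp [joint, hT, PMF.pure_apply, h]
  · simp [joint, hT, PMF.pure_apply, pmfReal]

/-- For injective deterministic dynamics, the Jensen–Shannon version of LfD
equals that of naive LfO: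
`D_JS(μπ ‖ μE) = D_JS(ρπ(s,s') ‖ ρE(s,s'))`. -/
theorem js_stateAction_eq_js_transMarg_of_injective_deterministic {S A : Type*}
    [Fintype S] [Fintype A] [Nonempty S] [Nonempty A]
    (f : S × A → S) (hf : ∀ s : S, Function.Injective fun a : A => f (s, a))
    (T : S × A → PMF S) (hT : ∀ p : S × A, T p = PMF.pure (f p))
    (μπ μE : PMF (S × A)) :
    jsDiv (pmfReal μπ) (pmfReal μE) = jsDiv (transMarg T μπ) (transMarg T μE) := by
  have hg : Function.Injective fun x : S × A => (x.1, f x) := by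
    rintro ⟨s, a⟩ ⟨s', a'⟩ h
    obtain ⟨rfl, h⟩ := Prod.mk.inj h
    exact Prod.ext rfl (hf s h)
  rw [← jsDiv_comp_of_injective _ hg _ _ (transMarg_eq_zero_of_notMem_range f T hT μπ)
    (transMarg_eq_zero_of_notMem_range f T hT μE), transMarg_comp_eq_pmfReal f hf T hT μπ,
    transMarg_comp_eq_pmfReal f hf T hT μE]
end
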